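/- (Theorem 1.1, for smooth solutions.) Assume (A.1), (A.2), (V.1), (V.2) with a fixed L > 0, and let C* > 0 be a constant for which the Poincaré-type inequality ∫_{|x|≤L} w² ≤ C*(∫_ℝ (w')² + ∫_{|x|≥L} w²) holds on H¹(ℝ). If V(0) < 1/(4C*), then there exists a constant C > 0 such that every smooth classical solution u of u_tt − u_xx + V(x)u + a(x)u_t = 0 on (0,∞) × ℝ with smooth compactly supported initial data u(0,·) = u₀, u_t(0,·) = u₁ satisfies, for all t ≥ 0: ‖u(t,·)‖_{L²} ≤ C I₀ and E_u(t) ≤ C I₀² (1+t)^{−1}, where I₀ := ‖u₀‖_{H¹} + ‖u₁‖_{L²} + ‖(u₁ + a·u₀)/√V‖_{L²}. -/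

import Mathlib

open MeasureTheory

noncomputable def ut (u : ℝ → ℝ → ℝ) (t x : ℝ) : ℝ := deriv (fun s => u s x) t

noncomputable def ux (u : ℝ → ℝ → ℝ) (t x : ℝ) : ℝ := deriv (fun y => u t y) x

noncomputable def utt (u : ℝ → ℝ → ℝ) (t x : ℝ) : ℝ := deriv (fun s => ut u s x) t

noncomputable def uxx (u : ℝ → ℝ → ℝ) (t x : ℝ) : ℝ := deriv (fun y => ux u t y) x

noncomputable def Eu (V : ℝ → ℝ) (u : ℝ → ℝ → ℝ) (t : ℝ) : ℝ :=
  (1/2) * ((∫ x, (ut u t x)^2) + (∫ x, (ux u t x)^2) + ∫ x, V x * (u t x)^2)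

/-- `u` is a smooth classical solution of `u_tt - u_xx + V u + a u_t = 0` with smooth
compactly supported initial data `(u₀, u₁)`, vanishing for large `|x|` on each `[0,T]`. -/
def IsSmoothSolution (V a : ℝ → ℝ) (u : ℝ → ℝ → ℝ) (u₀ u₁ : ℝ → ℝ) : Prop :=
  ContDiff ℝ (⊤ : ℕ∞) (fun p : ℝ × ℝ => u p.1 p.2) ∧
  (∀ t > (0:ℝ), ∀ x : ℝ, utt u t x - uxx u t x + V x * u t x + a x * ut u t x = 0) ∧
  (∀ x : ℝ, u 0 x = u₀ x) ∧ (∀ x : ℝ, ut u 0 x = u₁ x) ∧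
  ContDiff ℝ (⊤ : ℕ∞) u₀ ∧ HasCompactSupport u₀ ∧
  ContDiff ℝ (⊤ : ℕ∞) u₁ ∧ HasCompactSupport u₁ ∧
  (∀ T > (0:ℝ), ∃ R > (0:ℝ), ∀ t ∈ Set.Icc (0:ℝ) T, ∀ x : ℝ, R ≤ |x| → u t x = 0)

/-- The quantity `I₀ = ‖u₀‖_{H¹} + ‖u₁‖_{L²} + ‖(u₁ + a u₀)/√V‖_{L²}`. -/
noncomputable def I0 (a V u₀ u₁ : ℝ → ℝ) : ℝ :=
  Real.sqrt ((∫ x, u₀ x ^ 2) + ∫ x, (deriv u₀ x) ^ 2)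
    + Real.sqrt (∫ x, u₁ x ^ 2)
    + Real.sqrt (∫ x, (u₁ x + a x * u₀ x) ^ 2 / V x)

section WaveProof
open MeasureTheory Set Filter Topology

lemma hasDerivAt_param (G G' : ℝ → ℝ → ℝ) (hG : Continuous (fun z : ℝ × ℝ => G z.1 z.2))
    (hG' : Continuous (fun z : ℝ × ℝ => G' z.1 z.2))
    (h : ∀ t x, HasDerivAt (fun s => G s x) (G' t x) t) (a b t : ℝ) :
    HasDerivAt (fun s => ∫ x in a..b, G s x) (∫ x in a..b, G' t x) t := by
  have hc : IsCompact ((Icc (t-1) (t+1)) ×ˢ (uIcc a b)) := isCompact_Icc.prod isCompact_uIcc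
  obtain ⟨C, hC⟩ := hc.exists_bound_of_continuousOn hG'.continuousOn
  have c1 : ∀ s, Continuous (G s) := fun s =>
    hG.comp (by fun_prop : Continuous (fun x : ℝ => ((s, x) : ℝ × ℝ)))
  have c2 : ∀ s, Continuous (G' s) := fun s =>
    hG'.comp (by fun_prop : Continuous (fun x : ℝ => ((s, x) : ℝ × ℝ)))
  refine (intervalIntegral.hasDerivAt_integral_of_dominated_loc_of_deriv_le
    (μ := volume) (F := G) (F' := G') (s := Icc (t-1) (t+1)) (bound := fun _ => C)
    (Icc_mem_nhds (by linarith) (by linarith)) ?_ ?_ ?_ ?_ ?_ ?_).2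
  · exact Eventually.of_forall fun s => (c1 s).aestronglyMeasurable
  · exact (c1 t).intervalIntegrable _ _
  · exact (c2 t).aestronglyMeasurable
  · refine Eventually.of_forall fun x hx s hs => ?_
    exact hC (s, x) ⟨hs, uIoc_subset_uIcc hx⟩
  · exact intervalIntegrable_const
  · exact Eventually.of_forall fun x _ s _ => h s x

lemma cons_law (G G' : ℝ → ℝ → ℝ) (hG : Continuous (fun z : ℝ × ℝ => G z.1 z.2))
    (hG' : Continuous (fun z : ℝ × ℝ => G' z.1 z.2))
    (h : ∀ t x, HasDerivAt (fun s => G s x) (G' t x) t) (a b t : ℝ)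
    (J J' S : ℝ → ℝ) (hJ : ∀ x, HasDerivAt J (J' x) x) (hJ' : Continuous J')
    (hS : Continuous S) (ha : J a = 0) (hb : J b = 0)
    (he : ∀ x, G' t x = J' x + S x) :
    HasDerivAt (fun s => ∫ x in a..b, G s x) (∫ x in a..b, S x) t := by
  have h1 := hasDerivAt_param G G' hG hG' h a b t
  have h2 : ∫ x in a..b, G' t x = ∫ x in a..b, S x := by
    simp_rw [he]
    rw [intervalIntegral.integral_add (hJ'.intervalIntegrable _ _) (hS.intervalIntegrable _ _),
      intervalIntegral.integral_eq_sub_of_hasDerivAt (fun x _ => hJ x)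
        (hJ'.intervalIntegrable _ _), ha, hb]
    ring
  rwa [h2] at h1

/-- partial derivatives of a smooth function of two variables -/
lemma partial_t (f : ℝ → ℝ → ℝ) (hf : ContDiff ℝ (⊤ : ℕ∞) (fun z : ℝ × ℝ => f z.1 z.2)) (t x : ℝ) :
    HasDerivAt (fun s => f s x) (fderiv ℝ (fun z : ℝ × ℝ => f z.1 z.2) (t, x) (1, 0)) t := by
  have h1 : HasFDerivAt (fun z : ℝ × ℝ => f z.1 z.2)
      (fderiv ℝ (fun z : ℝ × ℝ => f z.1 z.2) (t, x)) (t, x) :=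
    (hf.differentiable (by simp) _).hasFDerivAt
  have h2 : HasDerivAt (fun s : ℝ => ((s, x) : ℝ × ℝ)) (1, 0) t :=
    (hasDerivAt_id t).prodMk (hasDerivAt_const t x)
  exact h1.comp_hasDerivAt t h2

lemma partial_x (f : ℝ → ℝ → ℝ) (hf : ContDiff ℝ (⊤ : ℕ∞) (fun z : ℝ × ℝ => f z.1 z.2)) (t x : ℝ) :
    HasDerivAt (fun s => f t s) (fderiv ℝ (fun z : ℝ × ℝ => f z.1 z.2) (t, x) (0, 1)) x := by
  have h1 : HasFDerivAt (fun z : ℝ × ℝ => f z.1 z.2)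
      (fderiv ℝ (fun z : ℝ × ℝ => f z.1 z.2) (t, x)) (t, x) :=
    (hf.differentiable (by simp) _).hasFDerivAt
  have h2 : HasDerivAt (fun s : ℝ => ((t, s) : ℝ × ℝ)) (0, 1) x :=
    (hasDerivAt_const x t).prodMk (hasDerivAt_id x)
  exact h1.comp_hasDerivAt x h2

lemma ut_eq (f : ℝ → ℝ → ℝ) (hf : ContDiff ℝ (⊤ : ℕ∞) (fun z : ℝ × ℝ => f z.1 z.2)) (t x : ℝ) :
    ut f t x = fderiv ℝ (fun z : ℝ × ℝ => f z.1 z.2) (t, x) (1, 0) := (partial_t f hf t x).deriv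

lemma ux_eq (f : ℝ → ℝ → ℝ) (hf : ContDiff ℝ (⊤ : ℕ∞) (fun z : ℝ × ℝ => f z.1 z.2)) (t x : ℝ) :
    ux f t x = fderiv ℝ (fun z : ℝ × ℝ => f z.1 z.2) (t, x) (0, 1) := (partial_x f hf t x).deriv

lemma ut_smooth (f : ℝ → ℝ → ℝ) (hf : ContDiff ℝ (⊤ : ℕ∞) (fun z : ℝ × ℝ => f z.1 z.2)) :
    ContDiff ℝ (⊤ : ℕ∞) (fun z : ℝ × ℝ => ut f z.1 z.2) := by
  simp_rw [ut_eq f hf]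
  exact (hf.fderiv_right (m := (⊤ : ℕ∞)) (by simp)).clm_apply contDiff_const

lemma ux_smooth (f : ℝ → ℝ → ℝ) (hf : ContDiff ℝ (⊤ : ℕ∞) (fun z : ℝ × ℝ => f z.1 z.2)) :
    ContDiff ℝ (⊤ : ℕ∞) (fun z : ℝ × ℝ => ux f z.1 z.2) := by
  simp_rw [ux_eq f hf]
  exact (hf.fderiv_right (m := (⊤ : ℕ∞)) (by simp)).clm_apply contDiff_const

lemma hasDerivAt_ut (f : ℝ → ℝ → ℝ) (hf : ContDiff ℝ (⊤ : ℕ∞) (fun z : ℝ × ℝ => f z.1 z.2))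
    (t x : ℝ) : HasDerivAt (fun s => f s x) (ut f t x) t := by
  rw [ut_eq f hf]; exact partial_t f hf t x

lemma hasDerivAt_ux (f : ℝ → ℝ → ℝ) (hf : ContDiff ℝ (⊤ : ℕ∞) (fun z : ℝ × ℝ => f z.1 z.2))
    (t x : ℝ) : HasDerivAt (fun s => f t s) (ux f t x) x := by
  rw [ux_eq f hf]; exact partial_x f hf t x

lemma mixed_eq (f : ℝ → ℝ → ℝ) (hf : ContDiff ℝ (⊤ : ℕ∞) (fun z : ℝ × ℝ => f z.1 z.2))
    (t x : ℝ) : ux (ut f) t x = ut (ux f) t x := by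
  have hsym := (hf.contDiffAt (x := (t, x))).isSymmSndFDerivAt (by
    simp only [minSmoothness_of_isRCLikeNormedField]; exact WithTop.coe_le_coe.2 (le_top : (2 : ℕ∞) ≤ ⊤))
  have hd : DifferentiableAt ℝ (fderiv ℝ (fun z : ℝ × ℝ => f z.1 z.2)) (t, x) :=
    (hf.fderiv_right (m := (⊤ : ℕ∞)) (by simp)).differentiable (by simp) _
  rw [ux_eq _ (ut_smooth f hf), ut_eq _ (ux_smooth f hf)]
  simp_rw [ut_eq f hf, ux_eq f hf]
  simp only [Prod.mk.eta]
  rw [fderiv_clm_apply hd (differentiableAt_const _), fderiv_clm_apply hd (differentiableAt_const _)]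
  simpa using hsym (0, 1) (1, 0)

lemma whole_eq (g : ℝ → ℝ) (R : ℝ) (hg : ∀ x, R ≤ |x| → g x = 0) :
    ∫ x, g x = ∫ x in (-R)..R, g x := by
  symm
  apply intervalIntegral.integral_eq_integral_of_support_subset
  intro x hx
  by_contra hn
  apply hx
  apply hg
  by_contra hlt
  rw [not_le, abs_lt] at hlt
  exact hn ⟨hlt.1, hlt.2.le⟩
lemma slice {f : ℝ → ℝ → ℝ} (hf : Continuous (fun z : ℝ × ℝ => f z.1 z.2)) (t : ℝ) :
    Continuous (f t) :=
  hf.comp (by fun_prop : Continuous (fun x : ℝ => ((t, x) : ℝ × ℝ)))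

lemma slice' {f : ℝ → ℝ → ℝ} (hf : Continuous (fun z : ℝ × ℝ => f z.1 z.2)) (x : ℝ) :
    Continuous (fun t => f t x) :=
  hf.comp (by fun_prop : Continuous (fun t : ℝ => ((t, x) : ℝ × ℝ)))

lemma energy_law (V a : ℝ → ℝ) (hV : Continuous V) (ha : Continuous a) (u : ℝ → ℝ → ℝ)
    (hf : ContDiff ℝ (⊤ : ℕ∞) (fun z : ℝ × ℝ => u z.1 z.2)) (R t : ℝ)
    (hpde : ∀ x, utt u t x - uxx u t x + V x * u t x + a x * ut u t x = 0)
    (h1 : ut u t R = 0) (h2 : ut u t (-R) = 0) :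
    HasDerivAt (fun s => ∫ x in (-R)..R,
      (1/2) * ((ut u s x)^2 + (ux u s x)^2 + V x * (u s x)^2))
      (∫ x in (-R)..R, -(a x * (ut u t x)^2)) t := by
  have c0 := hf.continuous
  have c1 := (ut_smooth u hf).continuous
  have c2 := (ux_smooth u hf).continuous
  have c3 := (ut_smooth _ (ut_smooth u hf)).continuous
  have c4 := (ut_smooth _ (ux_smooth u hf)).continuous
  have c5 := (ux_smooth _ (ux_smooth u hf)).continuous
  have s1 := slice c1 t
  have s2 := slice c2 t
  have s4 := slice c4 t
  have s5 := slice c5 t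
  refine cons_law _ (fun s x => ut u s x * ut (ut u) s x + ux u s x * ut (ux u) s x
      + V x * u s x * ut u s x) ?_ ?_ ?_ _ _ t
    (fun x => ut u t x * ux u t x)
    (fun x => ut (ux u) t x * ux u t x + ut u t x * ux (ux u) t x) _ ?_ ?_ ?_ ?_ ?_ ?_
  · fun_prop
  · fun_prop
  · intro s x
    have d1 := hasDerivAt_ut u hf s x
    have d2 := hasDerivAt_ut _ (ut_smooth u hf) s x
    have d3 := hasDerivAt_ut _ (ux_smooth u hf) s x
    refine ((((d2.pow 2).add (d3.pow 2)).add ((d1.pow 2).const_mul (V x))).const_mul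
      (1/2)).congr_deriv ?_
    simp only [Nat.cast_ofNat, Nat.reduceSub, pow_one]
    ring
  · intro x
    have d1 := hasDerivAt_ux _ (ut_smooth u hf) t x
    have d2 := hasDerivAt_ux _ (ux_smooth u hf) t x
    rw [mixed_eq u hf] at d1
    exact d1.mul d2
  · fun_prop
  · fun_prop
  · simp [h2]
  · simp [h1]
  · intro x
    have := hpde x
    change ut (ut u) t x - ux (ux u) t x + V x * u t x + a x * ut u t x = 0 at this
    linear_combination ut u t x * this

lemma morawetz_law (V a φ φ' : ℝ → ℝ) (hV : ContDiff ℝ 1 V) (ha : Continuous a)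
    (hφ : ∀ x, HasDerivAt φ (φ' x) x) (hφ' : Continuous φ') (u : ℝ → ℝ → ℝ)
    (hf : ContDiff ℝ (⊤ : ℕ∞) (fun z : ℝ × ℝ => u z.1 z.2)) (R t : ℝ)
    (hpde : ∀ x, utt u t x - uxx u t x + V x * u t x + a x * ut u t x = 0)
    (h1 : ut u t R = 0) (h2 : ut u t (-R) = 0)
    (h3 : ux u t R = 0) (h4 : ux u t (-R) = 0)
    (h5 : u t R = 0) (h6 : u t (-R) = 0) :
    HasDerivAt (fun s => ∫ x in (-R)..R,
      (φ x * (ut u s x * ux u s x) + (1/4) * (ut u s x * u s x) + (1/8) * (a x * (u s x)^2)))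
      (∫ x in (-R)..R, (-(1/2) * φ' x * ((ut u t x)^2 + (ux u t x)^2)
        + (1/2) * (φ' x * V x + φ x * deriv V x) * (u t x)^2
        - φ x * a x * ut u t x * ux u t x - (1/4) * (ux u t x)^2 + (1/4) * (ut u t x)^2
        - (1/4) * V x * (u t x)^2)) t := by
  have c0 := hf.continuous
  have c1 := (ut_smooth u hf).continuous
  have c2 := (ux_smooth u hf).continuous
  have c3 := (ut_smooth _ (ut_smooth u hf)).continuous
  have c4 := (ut_smooth _ (ux_smooth u hf)).continuous
  have c5 := (ux_smooth _ (ux_smooth u hf)).continuous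
  have s0 := slice c0 t
  have s1 := slice c1 t
  have s2 := slice c2 t
  have s4 := slice c4 t
  have s5 := slice c5 t
  have hVc := hV.continuous
  have hVd : Continuous (deriv V) := hV.continuous_deriv (by simp)
  have hφc : Continuous φ := continuous_iff_continuousAt.2 fun x => (hφ x).continuousAt
  refine cons_law _ (fun s x => φ x * (ut (ut u) s x * ux u s x + ut u s x * ut (ux u) s x)
      + (1/4) * (ut (ut u) s x * u s x + ut u s x * ut u s x)
      + (1/4) * (a x * (u s x * ut u s x))) ?_ ?_ ?_ _ _ t
    (fun x => (1/2) * (φ x * ((ux u t x)^2 + (ut u t x)^2 - V x * (u t x)^2))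
      + (1/4) * (u t x * ux u t x))
    (fun x => (1/2) * (φ' x * ((ux u t x)^2 + (ut u t x)^2 - V x * (u t x)^2)
        + φ x * (2 * ux u t x * ux (ux u) t x + 2 * ut u t x * ut (ux u) t x
          - (deriv V x * (u t x)^2 + V x * (2 * u t x * ux u t x))))
      + (1/4) * (ux u t x * ux u t x + u t x * ux (ux u) t x)) _ ?_ ?_ ?_ ?_ ?_ ?_
  · fun_prop
  · fun_prop
  · intro s x
    have d1 := hasDerivAt_ut u hf s x
    have d2 := hasDerivAt_ut _ (ut_smooth u hf) s x
    have d3 := hasDerivAt_ut _ (ux_smooth u hf) s x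
    refine ((((d2.mul d3).const_mul (φ x)).add ((d2.mul d1).const_mul (1/4))).add
      (((d1.pow 2).const_mul (a x)).const_mul (1/8))).congr_deriv ?_
    simp only [Nat.cast_ofNat, Nat.reduceSub, pow_one]
    ring
  · intro x
    have d0 := hasDerivAt_ux u hf t x
    have d1 := hasDerivAt_ux _ (ut_smooth u hf) t x
    have d2 := hasDerivAt_ux _ (ux_smooth u hf) t x
    have dV := (hV.differentiable (by simp) x).hasDerivAt
    rw [mixed_eq u hf] at d1
    refine ((((hφ x).mul (((d2.pow 2).add (d1.pow 2)).sub (dV.mul (d0.pow 2)))).const_mul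
      (1/2)).add ((d0.mul d2).const_mul (1/4))).congr_deriv ?_
    simp only [Nat.cast_ofNat, Nat.reduceSub, pow_one, Pi.pow_apply, Pi.sub_apply, Pi.add_apply,
      Pi.mul_apply]
  · fun_prop
  · fun_prop
  · simp [h2, h4, h6]
  · simp [h1, h3, h5]
  · intro x
    have := hpde x
    change ut (ut u) t x - ux (ux u) t x + V x * u t x + a x * ut u t x = 0 at this
    linear_combination (φ x * ux u t x + (1/4) * u t x) * this

noncomputable def vv (f : ℝ → ℝ → ℝ) (t x : ℝ) : ℝ := ∫ s in (0:ℝ)..t, f s x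

lemma vv_cont {f : ℝ → ℝ → ℝ} (hf : Continuous (fun z : ℝ × ℝ => f z.1 z.2)) :
    Continuous (fun z : ℝ × ℝ => vv f z.1 z.2) := by
  unfold vv
  exact intervalIntegral.continuous_parametric_intervalIntegral_of_continuous
    (f := fun (z : ℝ × ℝ) (s : ℝ) => f s z.2)
    (hf.comp (by fun_prop : Continuous (fun w : (ℝ × ℝ) × ℝ => ((w.2, w.1.2) : ℝ × ℝ))))
    continuous_fst

lemma vv_t {f : ℝ → ℝ → ℝ} (hf : Continuous (fun z : ℝ × ℝ => f z.1 z.2)) (t x : ℝ) :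
    HasDerivAt (fun s => vv f s x) (f t x) t := by
  unfold vv
  exact (slice' hf x).integral_hasStrictDerivAt 0 t |>.hasDerivAt

lemma vv_x (f : ℝ → ℝ → ℝ) (hf : ContDiff ℝ (⊤ : ℕ∞) (fun z : ℝ × ℝ => f z.1 z.2)) (t x : ℝ) :
    HasDerivAt (fun y => vv f t y) (vv (ux f) t x) x := by
  unfold vv
  exact hasDerivAt_param (fun y s => f s y) (fun y s => ux f s y)
    (hf.continuous.comp continuous_swap) ((ux_smooth f hf).continuous.comp continuous_swap)
    (fun y s => hasDerivAt_ux f hf s y) 0 t x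

lemma pde_zero (V a : ℝ → ℝ) (u : ℝ → ℝ → ℝ)
    (hf : ContDiff ℝ (⊤ : ℕ∞) (fun z : ℝ × ℝ => u z.1 z.2))
    (hpde : ∀ t > 0, ∀ x, utt u t x - uxx u t x + V x * u t x + a x * ut u t x = 0) :
    ∀ t ≥ 0, ∀ x, utt u t x - uxx u t x + V x * u t x + a x * ut u t x = 0 := by
  intro t ht x
  have c0 := slice' hf.continuous x
  have c1 := slice' (ut_smooth u hf).continuous x
  have c3 : Continuous (fun t => utt u t x) :=
    slice' (ut_smooth _ (ut_smooth u hf)).continuous x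
  have c5 : Continuous (fun t => uxx u t x) :=
    slice' (ux_smooth _ (ux_smooth u hf)).continuous x
  have hcl : IsClosed {t | utt u t x - uxx u t x + V x * u t x + a x * ut u t x = 0} :=
    isClosed_eq (by fun_prop) continuous_const
  have := hcl.closure_subset_iff.2 (fun t (ht : t ∈ Ioi (0:ℝ)) => hpde t ht x)
  rw [closure_Ioi] at this
  exact this ht

lemma int_eq (V a : ℝ → ℝ) (u : ℝ → ℝ → ℝ)
    (hf : ContDiff ℝ (⊤ : ℕ∞) (fun z : ℝ × ℝ => u z.1 z.2))
    (hpde : ∀ t ≥ 0, ∀ x, utt u t x - uxx u t x + V x * u t x + a x * ut u t x = 0)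
    (t : ℝ) (ht : 0 ≤ t) (x : ℝ) :
    ut u t x + a x * u t x + V x * vv u t x - vv (uxx u) t x = ut u 0 x + a x * u 0 x := by
  have c5 : Continuous (fun z : ℝ × ℝ => uxx u z.1 z.2) :=
    (ux_smooth _ (ux_smooth u hf)).continuous
  have hd : ∀ s, HasDerivAt
      (fun t => ut u t x + a x * u t x + V x * vv u t x - vv (uxx u) t x)
      (utt u s x + a x * ut u s x + V x * u s x - uxx u s x) s := by
    intro s
    exact (((hasDerivAt_ut _ (ut_smooth u hf) s x).add
      ((hasDerivAt_ut u hf s x).const_mul (a x))).add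
      ((vv_t hf.continuous s x).const_mul (V x))).sub (vv_t c5 s x)
  have := constant_of_has_deriv_right_zero (a := 0) (b := t)
    (fun s _ => (hd s).continuousAt.continuousWithinAt)
    (fun s hs => by
      have h := (hd s).hasDerivWithinAt (s := Ici s)
      have e := hpde s hs.1 x
      rwa [show utt u s x + a x * ut u s x + V x * u s x - uxx u s x = 0 by linarith] at h)
    t ⟨ht, le_rfl⟩
  rw [this]
  simp [vv]

lemma v_law (V a : ℝ → ℝ) (hV : Continuous V) (ha : Continuous a) (u : ℝ → ℝ → ℝ)
    (hf : ContDiff ℝ (⊤ : ℕ∞) (fun z : ℝ × ℝ => u z.1 z.2)) (R t : ℝ) (ht : 0 ≤ t)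
    (hpde : ∀ t ≥ 0, ∀ x, utt u t x - uxx u t x + V x * u t x + a x * ut u t x = 0)
    (h1 : u t R = 0) (h2 : u t (-R) = 0) :
    HasDerivAt (fun s => ∫ x in (-R)..R,
      ((1/2) * ((u s x)^2 + (vv (ux u) s x)^2 + V x * (vv u s x)^2)
        - (ut u 0 x + a x * u 0 x) * vv u s x))
      (∫ x in (-R)..R, -(a x * (u t x)^2)) t := by
  have c0 := hf.continuous
  have c1 := (ut_smooth u hf).continuous
  have c2 := (ux_smooth u hf).continuous
  have c5 := (ux_smooth _ (ux_smooth u hf)).continuous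
  have e0 := vv_cont c0
  have e2 := vv_cont c2
  have e5 := vv_cont c5
  have s0 := slice c0 t
  have s2 := slice c2 t
  have i0 := slice c0 0
  have i1 := slice c1 0
  have t2 := slice e2 t
  have t5 := slice e5 t
  refine cons_law _ (fun s x => u s x * ut u s x + vv (ux u) s x * ux u s x
      + V x * (vv u s x * u s x) - (ut u 0 x + a x * u 0 x) * u s x) ?_ ?_ ?_ _ _ t
    (fun x => vv (ux u) t x * u t x)
    (fun x => vv (ux (ux u)) t x * u t x + vv (ux u) t x * ux u t x) _ ?_ ?_ ?_ ?_ ?_ ?_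
  · fun_prop
  · fun_prop
  · intro s x
    have d1 := hasDerivAt_ut u hf s x
    have d2 := vv_t c0 s x
    have d3 := vv_t c2 s x
    refine (((((d1.pow 2).add (d3.pow 2)).add ((d2.pow 2).const_mul (V x))).const_mul
      (1/2)).sub (d2.const_mul (ut u 0 x + a x * u 0 x))).congr_deriv ?_
    simp only [Nat.cast_ofNat, Nat.reduceSub, pow_one]
    ring
  · intro x
    exact (vv_x _ (ux_smooth u hf) t x).mul (hasDerivAt_ux u hf t x)
  · fun_prop
  · fun_prop
  · simp [h2]
  · simp [h1]
  · intro x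
    have := int_eq V a u hf hpde t ht x
    change ut u t x + a x * u t x + V x * vv u t x - vv (ux (ux u)) t x
      = ut u 0 x + a x * u 0 x at this
    linear_combination u t x * this
lemma V_le (V : ℝ → ℝ) (hV : ContDiff ℝ 1 V) (hV2 : ∀ x, deriv V x * x ≤ 0) (x : ℝ) :
    V x ≤ V 0 := by
  have hd := hV.differentiable (by simp)
  rcases le_total 0 x with hx | hx
  · have : AntitoneOn V (Ici 0) := by
      refine antitoneOn_of_deriv_nonpos (convex_Ici 0) hV.continuous.continuousOn
        hd.differentiableOn ?_
      intro y hy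
      rw [interior_Ici] at hy
      have hy' : (0:ℝ) < y := hy
      by_contra hn
      exact absurd (hV2 y) (not_le.2 (mul_pos (not_le.1 hn) hy'))
    exact this self_mem_Ici hx hx
  · have : MonotoneOn V (Iic 0) := by
      refine monotoneOn_of_deriv_nonneg (convex_Iic 0) hV.continuous.continuousOn
        hd.differentiableOn ?_
      intro y hy
      rw [interior_Iic] at hy
      have hy' : y < (0:ℝ) := hy
      by_contra hn
      exact absurd (hV2 y) (not_le.2 (mul_pos_of_neg_of_neg (not_le.1 hn) hy'))
    exact this hx self_mem_Iic hx

lemma poincare_cons (a V : ℝ → ℝ) (L ε₁ Cstar : ℝ)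
    (hε₁ : 0 < ε₁) (hCstar : 0 < Cstar)
    (ha_cont : Continuous a) (ha_nonneg : ∀ x, 0 ≤ a x)
    (ha_eff : ∀ x : ℝ, L ≤ |x| → ε₁ ≤ a x)
    (hV : ContDiff ℝ 1 V) (hV_pos : ∀ x, 0 < V x)
    (hV2 : ∀ x, deriv V x * x ≤ 0)
    (hP : ∀ w : ℝ → ℝ, ContDiff ℝ 1 w →
      Integrable (fun x => w x ^ 2) → Integrable (fun x => deriv w x ^ 2) →
      ∫ x in {x : ℝ | |x| ≤ L}, w x ^ 2 ≤
        Cstar * ((∫ x, deriv w x ^ 2) + ∫ x in {x : ℝ | L ≤ |x|}, w x ^ 2))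
    (hV0 : V 0 < 1 / (4 * Cstar)) (w : ℝ → ℝ) (hw : ContDiff ℝ 1 w) (hc : HasCompactSupport w) :
    ∫ x, V x * w x ^ 2 ≤ (1/4) * (∫ x, deriv w x ^ 2)
      + (1/4 + V 0) / ε₁ * ∫ x, a x * w x ^ 2 := by
  have hwc := hw.continuous
  have hVc := hV.continuous
  have hwd : Continuous (deriv w) := hw.continuous_deriv (by simp)
  have hc2 : HasCompactSupport (fun x => w x ^ 2) := by
    have := hc.comp_left (g := fun y : ℝ => y ^ 2) (by simp)
    exact this
  have hcd2 : HasCompactSupport (fun x => deriv w x ^ 2) := by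
    have := hc.deriv.comp_left (g := fun y : ℝ => y ^ 2) (by simp)
    exact this
  have i1 : Integrable (fun x => w x ^ 2) := (hwc.pow 2).integrable_of_hasCompactSupport hc2
  have i2 : Integrable (fun x => deriv w x ^ 2) := (hwd.pow 2).integrable_of_hasCompactSupport hcd2
  have i3 : Integrable (fun x => V x * w x ^ 2) :=
    (hVc.mul (hwc.pow 2)).integrable_of_hasCompactSupport hc2.mul_left
  have i4 : Integrable (fun x => a x * w x ^ 2) :=
    (ha_cont.mul (hwc.pow 2)).integrable_of_hasCompactSupport hc2.mul_left
  have hmain := hP w hw i1 i2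
  have mS : MeasurableSet {x : ℝ | |x| ≤ L} := (isClosed_le continuous_abs continuous_const).measurableSet
  have mT : MeasurableSet {x : ℝ | L ≤ |x|} := (isClosed_le continuous_const continuous_abs).measurableSet
  have hout : ∫ x in {x : ℝ | L ≤ |x|}, w x ^ 2 ≤ (1/ε₁) * ∫ x, a x * w x ^ 2 := by
    rw [← integral_const_mul]
    calc ∫ x in {x : ℝ | L ≤ |x|}, w x ^ 2
        ≤ ∫ x in {x : ℝ | L ≤ |x|}, (1/ε₁) * (a x * w x ^ 2) := by
          refine setIntegral_mono_on i1.integrableOn (i4.const_mul _).integrableOn mT ?_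
          intro x hx
          have := ha_eff x hx
          rw [one_div, ← mul_assoc]
          have h1 : 1 ≤ ε₁⁻¹ * a x := by
            rw [inv_mul_eq_div, le_div_iff₀ hε₁]; linarith
          nlinarith [sq_nonneg (w x)]
      _ ≤ _ := by
          refine setIntegral_le_integral (i4.const_mul _) (Eventually.of_forall fun x => ?_)
          have := ha_nonneg x
          simp only [Pi.zero_apply]
          positivity
  have hin : ∫ x in {x : ℝ | |x| ≤ L}, V x * w x ^ 2 ≤ V 0 * ∫ x in {x : ℝ | |x| ≤ L}, w x ^ 2 := by
    rw [← integral_const_mul]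
    refine setIntegral_mono_on i3.integrableOn (i1.const_mul _).integrableOn mS ?_
    intro x _
    exact mul_le_mul_of_nonneg_right (V_le V hV hV2 x) (sq_nonneg _)
  have hco : ∫ x in {x : ℝ | |x| ≤ L}ᶜ, V x * w x ^ 2 ≤ V 0 * ∫ x in {x : ℝ | L ≤ |x|}, w x ^ 2 := by
    calc ∫ x in {x : ℝ | |x| ≤ L}ᶜ, V x * w x ^ 2 ≤ ∫ x in {x : ℝ | L ≤ |x|}, V x * w x ^ 2 := by
          refine setIntegral_mono_set i3.integrableOn (Eventually.of_forall fun x => ?_)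
            (LE.le.eventuallyLE ?_)
          · have := hV_pos x
            simp only [Pi.zero_apply]
            positivity
          · intro x hx
            have : ¬ |x| ≤ L := hx
            exact (not_le.1 this).le
      _ ≤ _ := by
          rw [← integral_const_mul]
          refine setIntegral_mono_on i3.integrableOn (i1.const_mul _).integrableOn mT ?_
          intro x _
          exact mul_le_mul_of_nonneg_right (V_le V hV hV2 x) (sq_nonneg _)
  have hsplit := integral_add_compl mS i3
  have hV00 := hV_pos 0
  have hVC : V 0 * Cstar ≤ 1/4 := by
    rw [lt_div_iff₀ (by positivity)] at hV0
    linarith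
  set O := ∫ x in {x : ℝ | L ≤ |x|}, w x ^ 2
  set N := ∫ x in {x : ℝ | |x| ≤ L}, w x ^ 2
  set D := ∫ x, deriv w x ^ 2
  set Q := ∫ x, a x * w x ^ 2
  have hD : 0 ≤ D := integral_nonneg fun x => sq_nonneg _
  have hO : 0 ≤ O := setIntegral_nonneg mT fun x _ => sq_nonneg _
  have e1 : V 0 * N ≤ (1/4) * (D + O) := by
    calc V 0 * N ≤ V 0 * (Cstar * (D + O)) := mul_le_mul_of_nonneg_left hmain hV00.le
      _ = (V 0 * Cstar) * (D + O) := by ring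
      _ ≤ _ := mul_le_mul_of_nonneg_right hVC (by positivity)
  have e2 : (1/4 + V 0) * O ≤ (1/4 + V 0) * ((1/ε₁) * Q) :=
    mul_le_mul_of_nonneg_left hout (by positivity)
  have e3 : (1/4 + V 0) * ((1/ε₁) * Q) = (1/4 + V 0) / ε₁ * Q := by ring
  rw [← hsplit, ← e3]
  linarith

/-- the pointwise inequality behind the Morawetz estimate -/
lemma pointwise_ineq (L ε₁ M A Vx Vd ph ph' p q w x : ℝ) (hL : 0 < L) (hε₁ : 0 < ε₁)
    (hA : 0 ≤ A) (hAM : A ≤ M) (hV : 0 < Vx)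
    (h1 : ph' ≤ 1) (h0 : 0 ≤ ph') (hin : |x| < L → 4/5 ≤ ph') (hout : L ≤ |x| → ε₁ ≤ A)
    (hph : |ph| ≤ 4 * L) (hs : ph * Vd ≤ 0) :
    -(1/2) * ph' * (p^2 + q^2) + (1/2) * (ph' * Vx + ph * Vd) * w^2
        - ph * A * p * q - (1/4) * q^2 + (1/4) * p^2 - (1/4) * Vx * w^2
      ≤ -(3/20) * p^2 - (3/16) * q^2 + (1/4) * (Vx * w^2)
        + ((2/5)/ε₁ + 64 * L^2 * M) * (A * p^2) := by
  have e1 : (1/4 - ph'/2) * p^2 ≤ -(3/20) * p^2 + (2/5)/ε₁ * A * p^2 := by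
    have : 1/4 - ph'/2 ≤ -(3/20) + (2/5)/ε₁ * A := by
      have hnn : 0 ≤ (2/5)/ε₁ * A := by positivity
      rcases lt_or_ge (|x|) L with h | h
      · have := hin h
        linarith
      · have := hout h
        have : 2/5 ≤ (2/5)/ε₁ * A := by
          rw [div_mul_eq_mul_div, le_div_iff₀ hε₁]; linarith
        linarith
    nlinarith [sq_nonneg p]
  have e2 : -(ph * A * p * q) ≤ (1/16) * q^2 + 64 * L^2 * M * (A * p^2) := by
    have hph2 : ph^2 ≤ 16 * L^2 := by
      have := sq_le_sq' (abs_le.1 hph).1 (abs_le.1 hph).2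
      linarith
    have hA2 : A * A ≤ M * A := mul_le_mul_of_nonneg_right hAM hA
    have k1 : -(ph * A * p * q) ≤ (1/16) * q^2 + 4 * (ph * A * p)^2 := by
      nlinarith [sq_nonneg ((1/4) * q + 2 * (ph * A * p))]
    have k2 : (ph * A * p)^2 ≤ 16 * L^2 * (M * A) * p^2 := by
      have : ph^2 * (A * A) ≤ 16 * L^2 * (M * A) := by gcongr
      calc (ph * A * p)^2 = ph^2 * (A * A) * p^2 := by ring
        _ ≤ _ := mul_le_mul_of_nonneg_right this (sq_nonneg p)
    linarith
  have e3 : (1/2) * ph' * (Vx * w^2) ≤ (1/2) * (Vx * w^2) := by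
    have : 0 ≤ Vx * w^2 := by positivity
    nlinarith
  have e4 : (ph * Vd) * w^2 ≤ 0 := mul_nonpos_of_nonpos_of_nonneg hs (sq_nonneg w)
  have e5 : 0 ≤ ph' * q^2 := by positivity
  nlinarith

/-- the multiplier -/
noncomputable def phi (L x : ℝ) : ℝ := 2 * L * Real.arctan (x / (2 * L))
noncomputable def phi' (L x : ℝ) : ℝ := 1 / (1 + (x / (2 * L))^2)

lemma phi_deriv (L : ℝ) (hL : 0 < L) (x : ℝ) : HasDerivAt (phi L) (phi' L x) x := by
  unfold phi phi'
  refine ((((hasDerivAt_id x).div_const (2 * L)).arctan).const_mul (2 * L)).congr_deriv ?_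
  simp only [id]
  field_simp

lemma phi'_cont (L : ℝ) : Continuous (phi' L) := by
  unfold phi'
  refine continuous_const.div (by fun_prop) (fun x => by positivity)

lemma phi'_le (L x : ℝ) : phi' L x ≤ 1 := by
  unfold phi'
  rw [div_le_one (by positivity)]
  nlinarith [sq_nonneg (x / (2 * L))]

lemma phi'_nonneg (L x : ℝ) : 0 ≤ phi' L x := by
  unfold phi'
  positivity

lemma phi'_ge (L x : ℝ) (hL : 0 < L) (hx : |x| < L) : 4/5 ≤ phi' L x := by
  unfold phi'
  rw [le_div_iff₀ (by positivity)]
  have : (x / (2 * L))^2 ≤ 1/4 := by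
    rw [div_pow, div_le_iff₀ (by positivity)]
    have := sq_le_sq' (abs_lt.1 hx).1.le (abs_lt.1 hx).2.le
    linarith
  linarith

lemma phi_abs (L x : ℝ) (hL : 0 < L) : |phi L x| ≤ 4 * L := by
  unfold phi
  have h1 := Real.arctan_lt_pi_div_two (x / (2 * L))
  have h2 := Real.neg_pi_div_two_lt_arctan (x / (2 * L))
  have h3 := Real.pi_lt_four
  rw [abs_mul, abs_of_pos (by positivity : 0 < 2 * L)]
  have : |Real.arctan (x / (2 * L))| ≤ 2 := by
    rw [abs_le]; constructor <;> linarith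
  nlinarith

lemma phi_sign (L x d : ℝ) (hL : 0 < L) (h : d * x ≤ 0) : phi L x * d ≤ 0 := by
  unfold phi
  rcases lt_trichotomy x 0 with hx | hx | hx
  · have h1 : Real.arctan (x / (2 * L)) < 0 := by
      rw [Real.arctan_lt_zero]; exact div_neg_of_neg_of_pos hx (by positivity)
    have h2 : 0 ≤ d := by
      by_contra hn
      exact absurd h (not_le.2 (mul_pos_of_neg_of_neg (not_le.1 hn) hx))
    exact mul_nonpos_of_nonpos_of_nonneg (by nlinarith) h2
  · simp [hx]
  · have h1 : 0 < Real.arctan (x / (2 * L)) := by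
      rw [Real.arctan_pos]; positivity
    have h2 : d ≤ 0 := by
      by_contra hn
      exact absurd h (not_le.2 (mul_pos (not_le.1 hn) hx))
    exact mul_nonpos_of_nonneg_of_nonpos (by positivity) h2
lemma lin4 {f g h k : ℝ → ℝ} (hf : Continuous f) (hg : Continuous g) (hh : Continuous h)
    (hk : Continuous k) (a b c1 c2 c3 c4 : ℝ) :
    ∫ x in a..b, (c1 * f x + c2 * g x + c3 * h x + c4 * k x)
      = c1 * (∫ x in a..b, f x) + c2 * (∫ x in a..b, g x) + c3 * (∫ x in a..b, h x)
        + c4 * ∫ x in a..b, k x := by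
  rw [intervalIntegral.integral_add, intervalIntegral.integral_add, intervalIntegral.integral_add,
    intervalIntegral.integral_const_mul, intervalIntegral.integral_const_mul,
    intervalIntegral.integral_const_mul, intervalIntegral.integral_const_mul] <;>
  exact Continuous.intervalIntegrable (by fun_prop) _ _

lemma int_le {f g : ℝ → ℝ} (hf : Continuous f) (hg : Continuous g) (R : ℝ) (hR : 0 ≤ R)
    (h : ∀ x, f x ≤ g x) : ∫ x in (-R)..R, f x ≤ ∫ x in (-R)..R, g x :=
  intervalIntegral.integral_mono (by linarith) (hf.intervalIntegrable _ _)
    (hg.intervalIntegrable _ _) h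

lemma decreasing (f f' : ℝ → ℝ) (t : ℝ) (ht : 0 ≤ t)
    (hf : ∀ s ∈ Icc 0 t, HasDerivAt f (f' s) s) (h : ∀ s ∈ Icc 0 t, f' s ≤ 0) : f t ≤ f 0 := by
  have : AntitoneOn f (Icc 0 t) := by
    refine antitoneOn_of_deriv_nonpos (convex_Icc 0 t)
      (fun s hs => (hf s hs).continuousAt.continuousWithinAt)
      (fun s hs => (hf s (interior_subset hs)).differentiableAt.differentiableWithinAt) ?_
    intro s hs
    rw [(hf s (interior_subset hs)).deriv]
    exact h s (interior_subset hs)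
  exact this ⟨le_rfl, ht⟩ ⟨ht, le_rfl⟩ ht

lemma support_facts (u : ℝ → ℝ → ℝ)
    (hf : ContDiff ℝ (⊤ : ℕ∞) (fun z : ℝ × ℝ => u z.1 z.2)) (T R : ℝ) (hT : 0 < T)
    (h : ∀ t ∈ Icc (0:ℝ) T, ∀ x : ℝ, R ≤ |x| → u t x = 0) :
    ∀ t ∈ Icc (0:ℝ) T, ∀ x : ℝ, R + 1 ≤ |x| → u t x = 0 ∧ ut u t x = 0 ∧ ux u t x = 0 := by
  intro t ht x hx
  refine ⟨h t ht x (by linarith), ?_, ?_⟩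
  · have hcl : IsClosed {s | ut u s x = 0} :=
      isClosed_eq (slice' (ut_smooth u hf).continuous x) continuous_const
    have := hcl.closure_subset_iff.2 (fun s (hs : s ∈ Ioo (0:ℝ) T) => by
      have : (fun r => u r x) =ᶠ[𝓝 s] fun _ => 0 := by
        filter_upwards [Ioo_mem_nhds hs.1 hs.2] with r hr
        exact h r ⟨hr.1.le, hr.2.le⟩ x (by linarith)
      change deriv (fun r => u r x) s = 0
      rw [this.deriv_eq]; simp)
    rw [closure_Ioo hT.ne] at this
    exact this ht
  · have : (fun y => u t y) =ᶠ[𝓝 x] fun _ => 0 := by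
      have ho : IsOpen {y : ℝ | R < |y|} := isOpen_lt continuous_const continuous_abs
      filter_upwards [ho.mem_nhds (show R < |x| by linarith)] with y hy
      exact h t ht y (le_of_lt hy)
    change deriv (fun y => u t y) x = 0
    rw [this.deriv_eq]; simp

set_option maxHeartbeats 2000000 in
lemma main_est
    (a V : ℝ → ℝ) (L ε₁ Cstar M : ℝ)
    (hL : 0 < L) (hε₁ : 0 < ε₁) (hCstar : 0 < Cstar)
    (ha_cont : Continuous a) (hM : ∀ x, |a x| ≤ M) (ha_nonneg : ∀ x, 0 ≤ a x)
    (ha_eff : ∀ x : ℝ, L ≤ |x| → ε₁ ≤ a x)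
    (hV : ContDiff ℝ 1 V) (hV_pos : ∀ x, 0 < V x)
    (hV2 : ∀ x, deriv V x * x ≤ 0)
    (hP : ∀ w : ℝ → ℝ, ContDiff ℝ 1 w →
      Integrable (fun x => w x ^ 2) → Integrable (fun x => deriv w x ^ 2) →
      ∫ x in {x : ℝ | |x| ≤ L}, w x ^ 2 ≤
        Cstar * ((∫ x, deriv w x ^ 2) + ∫ x in {x : ℝ | L ≤ |x|}, w x ^ 2))
    (hV0 : V 0 < 1 / (4 * Cstar))
    (κ₁ κ₂ : ℝ) (hκ₁ : κ₁ = (2/5)/ε₁ + 64 * L^2 * M + (4 * L + 1/4))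
    (hκ₂ : κ₂ = (1/4 + V 0) / ε₁ / 2 + 1/4)
    (u : ℝ → ℝ → ℝ) (u₀ u₁ : ℝ → ℝ) (hu : IsSmoothSolution V a u u₀ u₁) (t : ℝ) (ht : 0 ≤ t) :
    (∫ x, (u t x)^2) ≤ (∫ x, u₀ x ^ 2) + ∫ x, (u₁ x + a x * u₀ x) ^ 2 / V x ∧
    (1 + t) * Eu V u t ≤ (8 * (4 * L + 1/4 + κ₁) + 1) *
        ((1/2) * ((∫ x, u₁ x ^ 2) + (∫ x, (deriv u₀ x)^2) + V 0 * ∫ x, u₀ x ^ 2))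
      + (1 + M + 4 * κ₂) * (∫ x, u₀ x ^ 2)
      + 4 * κ₂ * ∫ x, (u₁ x + a x * u₀ x) ^ 2 / V x := by
  obtain ⟨hf, hpde', hu0, hu1, -, -, -, -, hsup⟩ := hu
  have hpde := pde_zero V a u hf hpde'
  obtain ⟨R0, hR0, hz⟩ := hsup (t + 1) (by linarith)
  have hzz := support_facts u hf (t + 1) R0 (by linarith) hz
  obtain ⟨R, hR⟩ : ∃ R, R = R0 + 1 := ⟨_, rfl⟩
  rw [← hR] at hzz
  have hRpos : 0 < R := by linarith
  have hsub : ∀ s ∈ Icc 0 t, s ∈ Icc 0 (t + 1) := fun s hs => ⟨hs.1, by linarith [hs.2]⟩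
  have zu : ∀ s ∈ Icc 0 t, ∀ x, R ≤ |x| → u s x = 0 := fun s hs x hx => (hzz s (hsub s hs) x hx).1
  have zt : ∀ s ∈ Icc 0 t, ∀ x, R ≤ |x| → ut u s x = 0 :=
    fun s hs x hx => (hzz s (hsub s hs) x hx).2.1
  have zx : ∀ s ∈ Icc 0 t, ∀ x, R ≤ |x| → ux u s x = 0 :=
    fun s hs x hx => (hzz s (hsub s hs) x hx).2.2
  have r1 : R ≤ |R| := le_abs_self R
  have r2 : R ≤ |-R| := by rw [abs_neg]; exact r1
  have c0 := hf.continuous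
  have c1 := (ut_smooth u hf).continuous
  have c2 := (ux_smooth u hf).continuous
  have s0 : ∀ s, Continuous (u s) := slice c0
  have s1 : ∀ s, Continuous (ut u s) := slice c1
  have s2 : ∀ s, Continuous (ux u s) := slice c2
  have w0 : ∀ s, Continuous (vv u s) := slice (vv_cont c0)
  have w2 : ∀ s, Continuous (vv (ux u) s) := slice (vv_cont c2)
  have hVc := hV.continuous
  have hVd : Continuous (deriv V) := hV.continuous_deriv (by simp)
  have hφc : Continuous (phi L) :=
    continuous_iff_continuousAt.2 fun x => (phi_deriv L hL x).continuousAt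
  have hφ'c := phi'_cont L
  have hM0 : 0 ≤ M := (abs_nonneg _).trans (hM 0)
  have hV00 := hV_pos 0
  have haM : ∀ x, a x ≤ M := fun x => (le_abs_self _).trans (hM x)
  -- the basic quadratic quantities
  let A : ℝ → ℝ := fun s => ∫ x in (-R)..R, (ut u s x)^2
  let B : ℝ → ℝ := fun s => ∫ x in (-R)..R, (ux u s x)^2
  let D : ℝ → ℝ := fun s => ∫ x in (-R)..R, V x * (u s x)^2
  let P : ℝ → ℝ := fun s => ∫ x in (-R)..R, a x * (ut u s x)^2
  let Q : ℝ → ℝ := fun s => ∫ x in (-R)..R, a x * (u s x)^2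
  let U : ℝ → ℝ := fun s => ∫ x in (-R)..R, (u s x)^2
  let H : ℝ := ∫ x in (-R)..R, (ut u 0 x + a x * u 0 x)^2 / V x
  let EE : ℝ → ℝ := fun s => ∫ x in (-R)..R,
      (1/2) * ((ut u s x)^2 + (ux u s x)^2 + V x * (u s x)^2)
  let FF : ℝ → ℝ := fun s => ∫ x in (-R)..R,
      (phi L x * (ut u s x * ux u s x) + (1/4) * (ut u s x * u s x) + (1/8) * (a x * (u s x)^2))
  let NN : ℝ → ℝ := fun s => ∫ x in (-R)..R,
      ((1/2) * ((u s x)^2 + (vv (ux u) s x)^2 + V x * (vv u s x)^2)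
        - (ut u 0 x + a x * u 0 x) * vv u s x)
  let Mo : ℝ → ℝ := fun t => ∫ x in (-R)..R, (-(1/2) * phi' L x * ((ut u t x)^2 + (ux u t x)^2)
        + (1/2) * (phi' L x * V x + phi L x * deriv V x) * (u t x)^2
        - phi L x * a x * ut u t x * ux u t x - (1/4) * (ux u t x)^2 + (1/4) * (ut u t x)^2
        - (1/4) * V x * (u t x)^2)
  have nn : ∀ g : ℝ → ℝ, (∀ x, 0 ≤ g x) → 0 ≤ ∫ x in (-R)..R, g x := fun g hg =>
    intervalIntegral.integral_nonneg (by linarith) (fun x _ => hg x)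
  have hA : ∀ s, 0 ≤ A s := fun s => nn _ fun x => sq_nonneg _
  have hB : ∀ s, 0 ≤ B s := fun s => nn _ fun x => sq_nonneg _
  have hD : ∀ s, 0 ≤ D s := fun s => nn _ fun x => mul_nonneg (hV_pos x).le (sq_nonneg _)
  have hPn : ∀ s, 0 ≤ P s := fun s => nn _ fun x => mul_nonneg (ha_nonneg x) (sq_nonneg _)
  have hQ : ∀ s, 0 ≤ Q s := fun s => nn _ fun x => mul_nonneg (ha_nonneg x) (sq_nonneg _)
  have hU : ∀ s, 0 ≤ U s := fun s => nn _ fun x => sq_nonneg _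
  have hE : ∀ s, EE s = (1/2) * (A s + B s + D s) := by
    intro s
    have := lin4 (f := fun x => (ut u s x)^2) (g := fun x => (ux u s x)^2)
      (h := fun x => V x * (u s x)^2) (k := fun _ => 0)
      (by fun_prop) (by fun_prop) (by fun_prop) (by fun_prop) (-R) R (1/2) (1/2) (1/2) 0
    simp only [EE, A, B, D]
    rw [show (fun x => (1/2) * ((ut u s x)^2 + (ux u s x)^2 + V x * (u s x)^2))
      = fun x => (1/2) * (ut u s x)^2 + (1/2) * (ux u s x)^2 + (1/2) * (V x * (u s x)^2) + 0 * 0 by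
        ext x; ring, this]
    ring
  have hEE : ∀ s, 0 ≤ EE s := fun s => by
    rw [hE]; have := hA s; have := hB s; have := hD s; positivity
  -- derivatives
  have dE : ∀ s ∈ Icc 0 t, HasDerivAt EE (- P s) s := by
    intro s hs
    have := energy_law V a hVc ha_cont u hf R s (hpde s hs.1) (zt s hs R r1) (zt s hs (-R) r2)
    rwa [intervalIntegral.integral_neg] at this
  have dN : ∀ s ∈ Icc 0 t, HasDerivAt NN (- Q s) s := by
    intro s hs
    have := v_law V a hVc ha_cont u hf R s hs.1 hpde (zu s hs R r1) (zu s hs (-R) r2)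
    rwa [intervalIntegral.integral_neg] at this
  have dF : ∀ s ∈ Icc 0 t, HasDerivAt FF (Mo s) s := by
    intro s hs
    exact morawetz_law V a (phi L) (phi' L) hV ha_cont (phi_deriv L hL) hφ'c u hf R s
      (hpde s hs.1) (zt s hs R r1) (zt s hs (-R) r2) (zx s hs R r1) (zx s hs (-R) r2)
      (zu s hs R r1) (zu s hs (-R) r2)
  -- Poincare
  have hPo : ∀ s ∈ Icc 0 t, D s ≤ (1/4) * B s + (1/4 + V 0) / ε₁ * Q s := by
    intro s hs
    have hw : ContDiff ℝ 1 (u s) := by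
      have : ContDiff ℝ (⊤ : ℕ∞) (u s) :=
        hf.comp (by fun_prop : ContDiff ℝ (⊤ : ℕ∞) (fun x : ℝ => ((s, x) : ℝ × ℝ)))
      exact this.of_le (WithTop.coe_le_coe.2 (le_top : (1 : ℕ∞) ≤ ⊤))
    have hc : HasCompactSupport (u s) := by
      refine HasCompactSupport.intro (isCompact_Icc (a := -R) (b := R)) ?_
      intro x hx
      apply zu s hs
      by_contra hlt
      exact hx (abs_le.1 (not_le.1 hlt).le)
    have h := poincare_cons a V L ε₁ Cstar hε₁ hCstar ha_cont ha_nonneg ha_eff hV hV_pos hV2 hP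
      hV0 (u s) hw hc
    rw [whole_eq (fun x => V x * u s x ^ 2) R (fun x hx => by simp [zu s hs x hx]),
      whole_eq (fun x => deriv (u s) x ^ 2) R (fun x hx => by
        have : deriv (u s) x = 0 := zx s hs x hx
        simp [this]),
      whole_eq (fun x => a x * u s x ^ 2) R (fun x hx => by simp [zu s hs x hx])] at h
    exact h
  -- Morawetz inequality
  have hMo : ∀ s ∈ Icc 0 t, 8 * Mo s ≤ - EE s + 8 * ((2/5)/ε₁ + 64 * L^2 * M) * P s
      + 8 * ((1/4 + V 0) / ε₁ / 2) * Q s := by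
    intro s hs
    have h1 : Mo s ≤ ∫ x in (-R)..R, (-(3/20) * (ut u s x)^2 + -(3/16) * (ux u s x)^2
        + (1/4) * (V x * (u s x)^2) + ((2/5)/ε₁ + 64 * L^2 * M) * (a x * (ut u s x)^2)) := by
      refine int_le (by fun_prop) (by fun_prop) R hRpos.le ?_
      intro x
      have := pointwise_ineq L ε₁ M (a x) (V x) (deriv V x) (phi L x) (phi' L x) (ut u s x)
        (ux u s x) (u s x) x hL hε₁ (ha_nonneg x) (haM x) (hV_pos x) (phi'_le L x)
        (phi'_nonneg L x) (phi'_ge L x hL) (ha_eff x) (phi_abs L x hL)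
        (phi_sign L x _ hL (hV2 x))
      linarith
    rw [lin4 (f := fun x => (ut u s x)^2) (g := fun x => (ux u s x)^2)
      (h := fun x => V x * (u s x)^2) (k := fun x => a x * (ut u s x)^2)
      (by fun_prop) (by fun_prop) (by fun_prop) (by fun_prop)] at h1
    change Mo s ≤ -(3/20) * A s + -(3/16) * B s + (1/4) * D s
      + ((2/5)/ε₁ + 64 * L^2 * M) * P s at h1
    have h2 := hPo s hs
    have h3 := hE s
    have := hA s
    have := hB s
    have := hD s
    linarith
  -- bounds of FF and NN
  have hFabs : ∀ s, - ((4 * L + 1/4) * EE s) - (1/8) * U s ≤ FF s ∧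
      FF s ≤ (4 * L + 1/4) * EE s + (1/8 + M/8) * U s := by
    intro s
    have key : ∀ x, |phi L x * (ut u s x * ux u s x)| ≤ 2 * L * ((ut u s x)^2 + (ux u s x)^2) := by
      intro x
      have h1 : |ut u s x * ux u s x| ≤ (1/2) * ((ut u s x)^2 + (ux u s x)^2) := by
        rw [abs_le]
        constructor
        · nlinarith [sq_nonneg (ut u s x + ux u s x)]
        · nlinarith [sq_nonneg (ut u s x - ux u s x)]
      rw [abs_mul]
      calc _ ≤ (4 * L) * ((1/2) * ((ut u s x)^2 + (ux u s x)^2)) :=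
            mul_le_mul (phi_abs L x hL) h1 (abs_nonneg _) (by positivity)
        _ = _ := by ring
    have l1 := lin4 (f := fun x => (ut u s x)^2) (g := fun x => (ux u s x)^2)
      (h := fun x => (u s x)^2) (k := fun _ => 0)
      (by fun_prop) (by fun_prop) (by fun_prop) (by fun_prop) (-R) R
      (-(2*L+1/8)) (-(2*L)) (-(1/8)) 0
    have l2 := lin4 (f := fun x => (ut u s x)^2) (g := fun x => (ux u s x)^2)
      (h := fun x => (u s x)^2) (k := fun _ => 0)
      (by fun_prop) (by fun_prop) (by fun_prop) (by fun_prop) (-R) R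
      (2*L+1/8) (2*L) (1/8+M/8) 0
    have e := hE s
    have hAs := hA s
    have hBs := hB s
    have hDs := hD s
    have p1 : 0 ≤ L * D s := by positivity
    constructor
    · have h1 : _ ≤ FF s := int_le (f := fun x => -(2*L+1/8) * (ut u s x)^2
          + -(2*L) * (ux u s x)^2 + -(1/8) * (u s x)^2 + 0 * 0)
          (by fun_prop) (by fun_prop) R hRpos.le (by
        intro x
        have k := (abs_le.1 (key x)).1
        have k2 : 0 ≤ a x * (u s x)^2 := mul_nonneg (ha_nonneg x) (sq_nonneg _)
        nlinarith [sq_nonneg (ut u s x + u s x)])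
      rw [l1] at h1
      change -(2*L+1/8) * A s + -(2*L) * B s + -(1/8) * U s + _ ≤ _ at h1
      rw [e]
      linarith
    · have h1 : FF s ≤ _ := int_le (g := fun x => (2*L+1/8) * (ut u s x)^2
          + (2*L) * (ux u s x)^2 + (1/8+M/8) * (u s x)^2 + 0 * 0)
          (by fun_prop) (by fun_prop) R hRpos.le (by
        intro x
        have k := (abs_le.1 (key x)).2
        have k2 : a x * (u s x)^2 ≤ M * (u s x)^2 :=
          mul_le_mul_of_nonneg_right (haM x) (sq_nonneg _)
        nlinarith [sq_nonneg (ut u s x - u s x)])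
      rw [l2] at h1
      change _ ≤ (2*L+1/8) * A s + (2*L) * B s + (1/8+M/8) * U s + _ at h1
      rw [e]
      linarith
  have hNlow : ∀ s, (1/2) * U s - (1/2) * H ≤ NN s := by
    intro s
    have i0 := s0 0
    have i1 := s1 0
    have ch : Continuous (fun x => (ut u 0 x + a x * u 0 x)^2 / V x) :=
      Continuous.div (by fun_prop) hVc (fun x => (hV_pos x).ne')
    have l1 := lin4 (f := fun x => (u s x)^2)
      (g := fun x => (ut u 0 x + a x * u 0 x)^2 / V x)
      (h := fun _ => 0) (k := fun _ => 0)
      (by fun_prop) ch (by fun_prop) (by fun_prop) (-R) R (1/2) (-(1/2)) 0 0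
    have e0 := w0 s
    have e2 := w2 s
    have h1 : _ ≤ NN s := int_le (f := fun x => (1/2) * (u s x)^2
          + -(1/2) * ((ut u 0 x + a x * u 0 x)^2 / V x) + 0 * 0 + 0 * 0)
          (by fun_prop) (by fun_prop) R hRpos.le (by
        intro x
        have hv := hV_pos x
        have k : (ut u 0 x + a x * u 0 x) * vv u s x ≤
            (1/2) * (V x * (vv u s x)^2) + (1/2) * ((ut u 0 x + a x * u 0 x)^2 / V x) := by
          have hq : 0 ≤ (V x * vv u s x - (ut u 0 x + a x * u 0 x))^2 / V x := by positivity
          have : (V x * vv u s x - (ut u 0 x + a x * u 0 x))^2 / V x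
            = V x * (vv u s x)^2 - 2 * ((ut u 0 x + a x * u 0 x) * vv u s x)
              + (ut u 0 x + a x * u 0 x)^2 / V x := by
            field_simp; ring
          linarith
        nlinarith [sq_nonneg (vv (ux u) s x)])
    rw [l1] at h1
    change (1/2) * U s + -(1/2) * H + _ + _ ≤ _ at h1
    linarith
  have hN0 : NN 0 = (1/2) * U 0 := by
    simp only [NN, U, vv, intervalIntegral.integral_same]
    rw [← intervalIntegral.integral_const_mul]
    congr 1
    ext x
    ring
  have hNle : NN t ≤ NN 0 := decreasing NN (fun s => - Q s) t ht dN (fun s _ => by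
    have := hQ s; linarith)
  have hκ₂0 : 1/4 ≤ κ₂ := by
    have : 0 ≤ (1/4 + V 0) / ε₁ / 2 := by positivity
    linarith
  -- the Lyapunov functional
  have hΨ : 8 * (FF t + κ₁ * EE t + κ₂ * NN t) + (1 + t) * EE t ≤
      8 * (FF 0 + κ₁ * EE 0 + κ₂ * NN 0) + (1 + 0) * EE 0 := by
    refine decreasing (fun s => 8 * (FF s + κ₁ * EE s + κ₂ * NN s) + (1 + s) * EE s)
      (fun s => 8 * (Mo s + κ₁ * (- P s) + κ₂ * (- Q s)) + (1 * EE s + (1 + s) * (- P s)))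
      t ht ?_ ?_
    · intro s hs
      exact ((((dF s hs).add ((dE s hs).const_mul κ₁)).add ((dN s hs).const_mul κ₂)).const_mul
        8).add (((hasDerivAt_id s).const_add 1).mul (dE s hs))
    · intro s hs
      have h1 := hMo s hs
      have h2 := hPn s
      have h3 := hQ s
      have h4 : 0 ≤ s * P s := mul_nonneg hs.1 h2
      have h5 : 0 ≤ L * P s := by positivity
      have h6 : κ₁ * P s = ((2/5)/ε₁ + 64 * L^2 * M) * P s + (4 * L + 1/4) * P s := by
        rw [hκ₁]; ring
      have h7 : κ₂ * Q s = ((1/4 + V 0) / ε₁ / 2) * Q s + (1/4) * Q s := by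
        rw [hκ₂]; ring
      linarith
  -- identification of whole-line integrals
  have m0 : (0:ℝ) ∈ Icc 0 t := ⟨le_rfl, ht⟩
  have mt : t ∈ Icc 0 t := ⟨ht, le_rfl⟩
  have f0 : u 0 = u₀ := funext hu0
  have f1 : ut u 0 = u₁ := funext hu1
  have fx : ux u 0 = deriv u₀ := by rw [← f0]; rfl
  have W1 : ∫ x, (u t x)^2 = U t := whole_eq _ R (fun x hx => by simp [zu t mt x hx])
  have W2 : ∫ x, u₀ x ^ 2 = U 0 := by
    rw [← f0]; exact whole_eq _ R (fun x hx => by simp [zu 0 m0 x hx])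
  have W3 : ∫ x, u₁ x ^ 2 = A 0 := by
    rw [← f1]; exact whole_eq _ R (fun x hx => by simp [zt 0 m0 x hx])
  have W4 : ∫ x, deriv u₀ x ^ 2 = B 0 := by
    rw [← fx]; exact whole_eq _ R (fun x hx => by simp [zx 0 m0 x hx])
  have W5 : ∫ x, (u₁ x + a x * u₀ x) ^ 2 / V x = H := by
    rw [← f1, ← f0]
    exact whole_eq _ R (fun x hx => by simp [zt 0 m0 x hx, zu 0 m0 x hx])
  have W6 : Eu V u t = EE t := by
    rw [hE]
    unfold Eu
    rw [whole_eq (fun x => (ut u t x)^2) R (fun x hx => by simp [zt t mt x hx]),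
      whole_eq (fun x => (ux u t x)^2) R (fun x hx => by simp [zx t mt x hx]),
      whole_eq (fun x => V x * (u t x)^2) R (fun x hx => by simp [zu t mt x hx])]
  have hDU : D 0 ≤ V 0 * U 0 := by
    simp only [D, U]
    rw [← intervalIntegral.integral_const_mul]
    have i0 := s0 0
    exact int_le (by fun_prop) (by fun_prop) R hRpos.le fun x =>
      mul_le_mul_of_nonneg_right (V_le V hV hV2 x) (sq_nonneg _)
  rw [W1, W2, W3, W4, W5, W6]
  clear_value A B D P Q U H EE FF NN Mo
  constructor
  · have := hNlow t
    linarith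
  · have h1 := (hFabs t).1
    have h2 := (hFabs 0).2
    have h3 := hNlow t
    have h4 : EE 0 ≤ (1/2) * (A 0 + B 0 + V 0 * U 0) := by rw [hE]; linarith
    have hκ₁0 : 4 * L + 1/4 ≤ κ₁ := by
      have : 0 ≤ (2/5)/ε₁ + 64 * L^2 * M := by positivity
      linarith
    have h5 : (4 * L + 1/4) * EE t ≤ κ₁ * EE t := mul_le_mul_of_nonneg_right hκ₁0 (hEE t)
    have h6 : κ₂ * ((1/2) * U t - (1/2) * H) ≤ κ₂ * NN t :=
      mul_le_mul_of_nonneg_left h3 (by linarith)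
    have h7 : (1/4) * U t ≤ κ₂ * U t := mul_le_mul_of_nonneg_right hκ₂0 (hU t)
    have h8 : (8 * (4 * L + 1/4 + κ₁) + 1) * EE 0 ≤ (8 * (4 * L + 1/4 + κ₁) + 1) *
        ((1/2) * (A 0 + B 0 + V 0 * U 0)) := by
      refine mul_le_mul_of_nonneg_left h4 ?_
      linarith
    rw [hN0] at hΨ
    linarith

end WaveProof

/-- **Theorem 1.1 (for smooth solutions).** Under (A.1), (A.2), (V.1), (V.2) with a
fixed `L > 0`, a Poincaré-type constant `C*`, and `V(0) < 1/(4C*)`, there is a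
constant `C > 0` such that every smooth classical solution of
`u_tt − u_xx + V u + a u_t = 0` with smooth compactly supported data satisfies
`‖u(t,·)‖ ≤ C I₀` and `E_u(t) ≤ C I₀² (1+t)⁻¹` for all `t ≥ 0`. -/
theorem theorem_1_1
    (a V : ℝ → ℝ) (L ε₁ Cstar : ℝ)
    (hL : 0 < L) (hε₁ : 0 < ε₁) (hCstar : 0 < Cstar)
    (ha_cont : Continuous a) (ha_bdd : ∃ M, ∀ x, |a x| ≤ M) (ha_nonneg : ∀ x, 0 ≤ a x)
    (ha_eff : ∀ x : ℝ, L ≤ |x| → ε₁ ≤ a x)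
    (hV : ContDiff ℝ 1 V) (hV_bdd : ∃ M, ∀ x, |V x| ≤ M)
    (hV'_bdd : ∃ M, ∀ x, |deriv V x| ≤ M) (hV_pos : ∀ x, 0 < V x)
    (hV2 : ∀ x, deriv V x * x ≤ 0)
    (hP : ∀ w : ℝ → ℝ, ContDiff ℝ 1 w →
      Integrable (fun x => w x ^ 2) → Integrable (fun x => deriv w x ^ 2) →
      ∫ x in {x : ℝ | |x| ≤ L}, w x ^ 2 ≤
        Cstar * ((∫ x, deriv w x ^ 2) + ∫ x in {x : ℝ | L ≤ |x|}, w x ^ 2))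
    (hV0 : V 0 < 1 / (4 * Cstar)) :
    ∃ C > (0:ℝ), ∀ (u : ℝ → ℝ → ℝ) (u₀ u₁ : ℝ → ℝ),
      IsSmoothSolution V a u u₀ u₁ →
      ∀ t ≥ (0:ℝ),
        Real.sqrt (∫ x, (u t x) ^ 2) ≤ C * I0 a V u₀ u₁ ∧
        Eu V u t ≤ C * (I0 a V u₀ u₁) ^ 2 * (1 + t)⁻¹ := by
  obtain ⟨M, hM⟩ := ha_bdd
  have hM0 : 0 ≤ M := (abs_nonneg _).trans (hM 0)
  have hV00 := hV_pos 0
  obtain ⟨κ₁, hκ₁⟩ : ∃ κ₁, κ₁ = (2/5)/ε₁ + 64 * L^2 * M + (4 * L + 1/4) := ⟨_, rfl⟩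
  obtain ⟨κ₂, hκ₂⟩ : ∃ κ₂, κ₂ = (1/4 + V 0) / ε₁ / 2 + 1/4 := ⟨_, rfl⟩
  have k1 : 0 ≤ κ₁ := by rw [hκ₁]; positivity
  have k2 : 0 ≤ κ₂ := by rw [hκ₂]; positivity
  refine ⟨1 + (8 * (4 * L + 1/4 + κ₁) + 1) * (1 + V 0) + (1 + M + 4 * κ₂), by positivity, ?_⟩
  intro u u₀ u₁ hu t ht
  obtain ⟨e1, e2⟩ := main_est a V L ε₁ Cstar M hL hε₁ hCstar ha_cont hM ha_nonneg ha_eff hV hV_pos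
    hV2 hP hV0 κ₁ κ₂ hκ₁ hκ₂ u u₀ u₁ hu t ht
  have nU : 0 ≤ ∫ x, u₀ x ^ 2 := integral_nonneg fun x => sq_nonneg _
  have nB : 0 ≤ ∫ x, deriv u₀ x ^ 2 := integral_nonneg fun x => sq_nonneg _
  have nA : 0 ≤ ∫ x, u₁ x ^ 2 := integral_nonneg fun x => sq_nonneg _
  have nH : 0 ≤ ∫ x, (u₁ x + a x * u₀ x) ^ 2 / V x :=
    integral_nonneg fun x => div_nonneg (sq_nonneg _) (hV_pos x).le
  have hI0 : 0 ≤ I0 a V u₀ u₁ := by unfold I0; positivity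
  have hI : (∫ x, u₀ x ^ 2) + (∫ x, deriv u₀ x ^ 2) + (∫ x, u₁ x ^ 2)
      + (∫ x, (u₁ x + a x * u₀ x) ^ 2 / V x) ≤ I0 a V u₀ u₁ ^ 2 := by
    unfold I0
    have q1 := Real.sq_sqrt (add_nonneg nU nB)
    have q2 := Real.sq_sqrt nA
    have q3 := Real.sq_sqrt nH
    have p1 := Real.sqrt_nonneg ((∫ x, u₀ x ^ 2) + ∫ x, deriv u₀ x ^ 2)
    have p2 := Real.sqrt_nonneg (∫ x, u₁ x ^ 2)
    have p3 := Real.sqrt_nonneg (∫ x, (u₁ x + a x * u₀ x) ^ 2 / V x)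
    nlinarith [mul_nonneg p1 p2, mul_nonneg p1 p3, mul_nonneg p2 p3]
  set I := I0 a V u₀ u₁
  set X := ∫ x, u₀ x ^ 2
  set B := ∫ x, deriv u₀ x ^ 2
  set A := ∫ x, u₁ x ^ 2
  set H := ∫ x, (u₁ x + a x * u₀ x) ^ 2 / V x
  have hc1 : 0 ≤ (8 * (4 * L + 1/4 + κ₁) + 1) * (1 + V 0) := by positivity
  constructor
  · have h1 : Real.sqrt (∫ x, (u t x) ^ 2) ≤ I := by
      rw [Real.sqrt_le_left hI0]
      linarith
    nlinarith
  · rw [← div_eq_mul_inv, le_div_iff₀ (by linarith), mul_comm]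
    refine e2.trans ?_
    have hXI : X ≤ I ^ 2 := by linarith
    have h1 : (1/2) * (A + B + V 0 * X) ≤ (1 + V 0) * I ^ 2 := by
      have : V 0 * X ≤ V 0 * I ^ 2 := mul_le_mul_of_nonneg_left hXI hV00.le
      nlinarith
    have h2 : (8 * (4 * L + 1/4 + κ₁) + 1) * ((1/2) * (A + B + V 0 * X))
        ≤ (8 * (4 * L + 1/4 + κ₁) + 1) * ((1 + V 0) * I ^ 2) :=
      mul_le_mul_of_nonneg_left h1 (by positivity)
    have h3 : (1 + M) * X ≤ (1 + M) * I ^ 2 := mul_le_mul_of_nonneg_left hXI (by positivity)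
    have h4 : 4 * κ₂ * (X + H) ≤ 4 * κ₂ * I ^ 2 :=
      mul_le_mul_of_nonneg_left (by linarith) (by positivity)
    nlinarith [sq_nonneg I]
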